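/- arXiv:2510.05089 — 9 statements merged into one kernel-verified Lean document; each statement's English description precedes it below -/
import Mathlib

section
/- Let X be a finite set, ε ∈ (0,1], and N : X → (0,1] a measure with strictly positive entries. Let c ≥ 1 be the smallest constant such that the measure M* defined by M*(x) = min(1, c·N(x)) has density μ(M*) = ε (i.e., μ(min(1, c·N)) = ε and no c' with 1 ≤ c' < c satisfies μ(min(1, c'·N)) = ε). Then M* is the Bregman projection of N onto Γ_ε: for every measure M ∈ Γ_ε one has KL(M*||N) ≤ KL(M||N). -/
/-- The gradient inequality for the convex function `t ↦ t * log (t / n) + n - t`. -/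
lemma kl_term_add_log_mul_sub_le {m p n : ℝ} (hm : 0 ≤ m) (hp : 0 < p) (hn : 0 < n) :
    p * Real.log (p / n) + n - p + Real.log (p / n) * (m - p)
      ≤ m * Real.log (m / n) + n - m := by
  rcases hm.eq_or_lt with rfl | hm
  · simp only [zero_mul]
    linarith
  · have h := mul_le_mul_of_nonneg_left (Real.log_le_sub_one_of_pos (div_pos hp hm)) hm.le
    rw [mul_sub, mul_div_cancel₀ _ hm.ne', Real.log_div hp.ne' hm.ne'] at h
    rw [Real.log_div hp.ne' hn.ne', Real.log_div hm.ne' hn.ne']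
    linarith

/-- Complementary slackness for the truncation `min 1 (c * n)`. -/
lemma log_mul_sub_min_le {m n c : ℝ} (hm : m ≤ 1) (hn : 0 < n) :
    Real.log c * (m - min 1 (c * n))
      ≤ Real.log (min 1 (c * n) / n) * (m - min 1 (c * n)) := by
  rcases le_total 1 (c * n) with h | h
  · rw [min_eq_left h]
    exact mul_le_mul_of_nonpos_right
      (Real.log_le_log (by positivity) ((div_le_iff₀ hn).2 h)) (by linarith)
  · rw [min_eq_right h, mul_div_cancel_right₀ _ hn.ne']


/-- Implicit representation of the Bregman projection: Let `N : X → (0,1]`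
be a measure on a finite set `X`, `ε ∈ (0,1]`, and let `c ≥ 1` be the smallest constant
such that `M* = min(1, c·N)` has density `ε`. Then `M*` is the Bregman projection of `N`
onto `Γ_ε`: `KL(M*||N) ≤ KL(M||N)` for every measure `M ∈ Γ_ε`. -/
theorem stmt_4 {X : Type*} [Fintype X] [Nonempty X]
    (ε : ℝ) (hε : 0 < ε) (hε1 : ε ≤ 1)
    (N : X → ℝ) (hN : ∀ x, 0 < N x ∧ N x ≤ 1)
    (c : ℝ) (hc : 1 ≤ c)
    (hdens : (∑ x, min 1 (c * N x)) / (Fintype.card X : ℝ) = ε)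
    (hmin : ∀ c', 1 ≤ c' → c' < c →
      (∑ x, min 1 (c' * N x)) / (Fintype.card X : ℝ) ≠ ε) :
    ∀ M : X → ℝ, (∀ x, 0 ≤ M x ∧ M x ≤ 1) →
      (∑ x, M x) / (Fintype.card X : ℝ) ≥ ε →
      ∑ x, (min 1 (c * N x) * Real.log (min 1 (c * N x) / N x) + N x - min 1 (c * N x))
        ≤ ∑ x, (M x * Real.log (M x / N x) + N x - M x) := by
  intro M hM hMdens
  have hcard : (0 : ℝ) < Fintype.card X := by exact_mod_cast Fintype.card_pos
  have hsum : ∑ x, min 1 (c * N x) ≤ ∑ x, M x := by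
    rw [← hdens] at hMdens
    exact (div_le_div_iff_of_pos_right hcard).1 hMdens
  have hgap : 0 ≤ ∑ x, Real.log c * (M x - min 1 (c * N x)) := by
    rw [← Finset.mul_sum, Finset.sum_sub_distrib]
    exact mul_nonneg (Real.log_nonneg hc) (sub_nonneg.2 hsum)
  refine (le_add_of_nonneg_right hgap).trans ?_
  rw [← Finset.sum_add_distrib]
  refine Finset.sum_le_sum fun x _ => ?_
  have hp : 0 < min 1 (c * N x) :=
    lt_min one_pos (mul_pos (one_pos.trans_le hc) (hN x).1)
  exact (add_le_add_right (log_mul_sub_min_le (hM x).2 (hN x).1) _).trans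
    (kl_term_add_log_mul_sub_le (hM x).1 hp (hN x).1)
end

section
/- (Bregman's theorem, discrete KL setting.) Let X be a finite set, ε ∈ (0,1], and N : X → (0,1] a measure with strictly positive entries. Let M* ∈ Γ_ε with M*(x) > 0 for all x be the exact Bregman projection of N onto Γ_ε, i.e., KL(M*||N) ≤ KL(M'||N) for all M' ∈ Γ_ε. Then for every measure M ∈ Γ_ε: KL(M||M*) + KL(M*||N) ≤ KL(M||N). -/
/-- The three-point identity for the summands of the Kullback-Leibler divergence. -/
theorem kl_summand_three_point {m p n : ℝ} (hp : p ≠ 0) (hn : n ≠ 0) :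
    m * Real.log (m / n) + n - m
      = (m * Real.log (m / p) + p - m) + (p * Real.log (p / n) + n - p)
        + (m - p) * Real.log (p / n) := by
  rcases eq_or_ne m 0 with rfl | hm
  · ring
  · rw [Real.log_div hm hn, Real.log_div hm hp, Real.log_div hp hn]
    ring

/-- The derivative at `t = 0` of a summand of the Kullback-Leibler divergence along
`t ↦ p + t * d`. -/
theorem hasDerivAt_kl_summand_line {p n : ℝ} (d : ℝ) (hp : p ≠ 0) (hn : n ≠ 0) :
    HasDerivAt (fun t : ℝ => (p + t * d) * Real.log ((p + t * d) / n) + n - (p + t * d))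
      (d * Real.log (p / n)) 0 := by
  have hline : HasDerivAt (fun t : ℝ => p + t * d) d 0 := by
    simpa using ((hasDerivAt_id (0 : ℝ)).mul_const d).const_add p
  have hlog : HasDerivAt (fun t : ℝ => Real.log ((p + t * d) / n)) (d / n / (p / n)) 0 := by
    simpa using (hline.div_const n).log (by simpa using div_ne_zero hp hn)
  refine (((hline.mul hlog).add_const n).sub hline).congr_deriv ?_
  simp only [zero_mul, add_zero]
  field_simp
  ring

/-- A function that is minimized at `0` among points of `[0, 1]` has nonnegative derivative
at `0`. -/
theorem deriv_nonneg_of_le_on_unit_interval {f : ℝ → ℝ} {f' : ℝ} (hf : HasDerivAt f f' 0)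
    (hmin : ∀ t : ℝ, 0 < t → t ≤ 1 → f 0 ≤ f t) : 0 ≤ f' := by
  refine ge_of_tendsto hf.tendsto_slope_zero_right ?_
  filter_upwards [Ioc_mem_nhdsGT (zero_lt_one' ℝ)] with t ht
  have := hmin t ht.1 ht.2
  rw [zero_add, smul_eq_mul]
  exact mul_nonneg (inv_nonneg.2 ht.1.le) (sub_nonneg.2 this)

/-- Bregman's theorem, discrete KL setting: Let `X` be a finite set,
`ε ∈ (0,1]`, `N : X → (0,1]` a measure with strictly positive entries, and let
`M* ∈ Γ_ε` with strictly positive entries be the exact Bregman projection of `N` onto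
`Γ_ε` (i.e. `KL(M*||N) ≤ KL(M'||N)` for all `M' ∈ Γ_ε`). Then for every `M ∈ Γ_ε`:
`KL(M||M*) + KL(M*||N) ≤ KL(M||N)`. -/
theorem stmt_5 {X : Type*} [Fintype X] [Nonempty X]
    (ε : ℝ) (hε : 0 < ε) (hε1 : ε ≤ 1)
    (N : X → ℝ) (hN : ∀ x, 0 < N x ∧ N x ≤ 1)
    (Mstar : X → ℝ) (hMstar : ∀ x, 0 < Mstar x ∧ Mstar x ≤ 1)
    (hMstarDens : (∑ x, Mstar x) / (Fintype.card X : ℝ) ≥ ε)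
    (hproj : ∀ M' : X → ℝ, (∀ x, 0 ≤ M' x ∧ M' x ≤ 1) →
      (∑ x, M' x) / (Fintype.card X : ℝ) ≥ ε →
      ∑ x, (Mstar x * Real.log (Mstar x / N x) + N x - Mstar x)
        ≤ ∑ x, (M' x * Real.log (M' x / N x) + N x - M' x)) :
    ∀ M : X → ℝ, (∀ x, 0 ≤ M x ∧ M x ≤ 1) →
      (∑ x, M x) / (Fintype.card X : ℝ) ≥ ε →
      (∑ x, (M x * Real.log (M x / Mstar x) + Mstar x - M x))
        + (∑ x, (Mstar x * Real.log (Mstar x / N x) + N x - Mstar x))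
        ≤ ∑ x, (M x * Real.log (M x / N x) + N x - M x) := by
  intro M hM hMDens
  have hcard : (0 : ℝ) < Fintype.card X := by exact_mod_cast Fintype.card_pos
  have hderiv := HasDerivAt.fun_sum (u := Finset.univ) fun x _ =>
    hasDerivAt_kl_summand_line (M x - Mstar x) (hMstar x).1.ne' (hN x).1.ne'
  have hnonneg : 0 ≤ ∑ x, (M x - Mstar x) * Real.log (Mstar x / N x) := by
    refine deriv_nonneg_of_le_on_unit_interval hderiv fun t ht0 ht1 => ?_
    simp only [zero_mul, add_zero]
    refine hproj (fun x => Mstar x + t * (M x - Mstar x)) (fun x => ⟨?_, ?_⟩) ?_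
    · nlinarith [mul_nonneg ht0.le (hM x).1,
        mul_nonneg (sub_nonneg.2 ht1) (hMstar x).1.le]
    · nlinarith [mul_nonneg ht0.le (sub_nonneg.2 (hM x).2),
        mul_nonneg (sub_nonneg.2 ht1) (sub_nonneg.2 (hMstar x).2)]
    · rw [ge_iff_le, le_div_iff₀ hcard] at hMDens hMstarDens ⊢
      rw [Finset.sum_add_distrib, ← Finset.mul_sum, Finset.sum_sub_distrib]
      nlinarith [mul_nonneg ht0.le (sub_nonneg.2 hMDens),
        mul_nonneg (sub_nonneg.2 ht1) (sub_nonneg.2 hMstarDens)]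
  rw [Finset.sum_congr rfl fun x _ =>
      kl_summand_three_point (m := M x) (hMstar x).1.ne' (hN x).1.ne',
    Finset.sum_add_distrib, Finset.sum_add_distrib]
  exact le_add_of_nonneg_right hnonneg
end

section
/- Let X be a finite set with |X| = m, and let ε, ζ ∈ (0,1). Let M_E, M*, M̃ : X → [0,1] be measures with strictly positive entries satisfying |M_E| = εm, |M*| = εm, and |M̃| ≥ εm. If KL(M_E||M̃) ≤ KL(M_E||M*) + ζεm, then RE(D_{M_E}||D_{M̃}) ≤ RE(D_{M_E}||D_{M*}) + ζ, where D_M = M/|M| denotes the normalized distribution of a measure M. -/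
/-- Relative entropy of two normalized positive functions in terms of the unnormalized ones. -/
theorem sum_div_mul_log_div_div {X : Type*} [Fintype X] [Nonempty X] (M N : X → ℝ)
    (hM : ∀ x, 0 < M x) (hN : ∀ x, 0 < N x) :
    ∑ x, (M x / ∑ y, M y) * Real.log ((M x / ∑ y, M y) / (N x / ∑ y, N y))
      = (∑ x, M x * Real.log (M x / N x)) / (∑ y, M y)
        + Real.log ((∑ y, N y) / ∑ y, M y) := by
  have hMs : 0 < ∑ y, M y := Finset.sum_pos (fun x _ => hM x) Finset.univ_nonempty
  have hNs : 0 < ∑ y, N y := Finset.sum_pos (fun x _ => hN x) Finset.univ_nonempty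
  have key : ∀ x, (M x / ∑ y, M y) * Real.log ((M x / ∑ y, M y) / (N x / ∑ y, N y))
      = M x * Real.log (M x / N x) / (∑ y, M y)
        + M x / (∑ y, M y) * Real.log ((∑ y, N y) / ∑ y, M y) := by
    intro x
    have h : (M x / ∑ y, M y) / (N x / ∑ y, N y)
        = (M x / N x) * ((∑ y, N y) / ∑ y, M y) := by
      rw [div_div_div_eq, div_mul_div_comm, mul_comm (N x)]
    rw [h, Real.log_mul (div_pos (hM x) (hN x)).ne' (div_pos hNs hMs).ne']
    ring
  rw [Finset.sum_congr rfl fun x _ => key x, Finset.sum_add_distrib, ← Finset.sum_div,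
    ← Finset.sum_mul, ← Finset.sum_div, div_self hMs.ne', one_mul]

/-- Let `X` be a finite set with `|X| = m`, `ε, ζ ∈ (0,1)`, and
`M_E, M*, M̃ : X → (0,1]` measures with `|M_E| = εm`, `|M*| = εm`, `|M̃| ≥ εm`.
If `KL(M_E||M̃) ≤ KL(M_E||M*) + ζεm`, then
`RE(D_{M_E}||D_{M̃}) ≤ RE(D_{M_E}||D_{M*}) + ζ`. -/
theorem stmt_6 {X : Type*} [Fintype X] [Nonempty X]
    (m : ℕ) (hm : Fintype.card X = m)
    (ε ζ : ℝ) (hε : 0 < ε) (hε1 : ε < 1) (hζ : 0 < ζ) (hζ1 : ζ < 1)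
    (ME Mstar Mt : X → ℝ)
    (hME : ∀ x, 0 < ME x ∧ ME x ≤ 1)
    (hMstar : ∀ x, 0 < Mstar x ∧ Mstar x ≤ 1)
    (hMt : ∀ x, 0 < Mt x ∧ Mt x ≤ 1)
    (hMEw : ∑ x, ME x = ε * m)
    (hMstarw : ∑ x, Mstar x = ε * m)
    (hMtw : ∑ x, Mt x ≥ ε * m)
    (hKL : ∑ x, (ME x * Real.log (ME x / Mt x) + Mt x - ME x)
      ≤ (∑ x, (ME x * Real.log (ME x / Mstar x) + Mstar x - ME x)) + ζ * ε * m) :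
    ∑ x, (ME x / ∑ y, ME y) *
        Real.log ((ME x / ∑ y, ME y) / (Mt x / ∑ y, Mt y))
      ≤ (∑ x, (ME x / ∑ y, ME y) *
          Real.log ((ME x / ∑ y, ME y) / (Mstar x / ∑ y, Mstar y))) + ζ := by
  have hW : 0 < ε * m := hMEw ▸ Finset.sum_pos (fun x _ => (hME x).1) Finset.univ_nonempty
  rw [sum_div_mul_log_div_div ME Mt (fun x => (hME x).1) (fun x => (hMt x).1),
    sum_div_mul_log_div_div ME Mstar (fun x => (hME x).1) (fun x => (hMstar x).1),
    hMEw, hMstarw, div_self hW.ne', Real.log_one, add_zero]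
  simp only [Finset.sum_sub_distrib, Finset.sum_add_distrib, hMEw, hMstarw] at hKL
  have hlog := Real.log_le_sub_one_of_pos (div_pos (hW.trans_le hMtw) hW)
  have hdiv := div_le_div_of_nonneg_right hKL hW.le
  have hz : ζ * ε * m / (ε * m) = ζ := by
    rw [mul_assoc, mul_div_cancel_right₀ _ hW.ne']
  simp only [sub_div, add_div, div_self hW.ne', hz] at hdiv
  linarith
end

section
/- Let X be a finite set with |X| = m, ε ∈ (0,1], and N : X → (0,1] a measure with strictly positive entries. Let M* ∈ Γ_ε with strictly positive entries and |M*| = εm be the exact Bregman projection of N onto Γ_ε (i.e., KL(M*||N) ≤ KL(M'||N) for all M' ∈ Γ_ε). Then for every measure M_E ∈ Γ_ε with |M_E| = εm: RE(D_{M_E}||D_N) ≥ RE(D_{M_E}||D_{M*}) + RE(D_{M*}||D_N), and in particular RE(D_{M_E}||D_N) ≥ RE(D_{M_E}||D_{M*}), where D_M = M/|M| denotes the normalized distribution of a measure M. -/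
/-- Chain rule for the summands of the relative entropy. -/
theorem mul_log_div_eq_add (a : ℝ) {p n : ℝ} (hp : 0 < p) (hn : 0 < n) :
    a * Real.log (a / n) = a * Real.log (a / p) + a * Real.log (p / n) := by
  rcases eq_or_ne a 0 with rfl | ha
  · simp
  · rw [Real.log_div ha hn.ne', Real.log_div ha hp.ne', Real.log_div hp.ne' hn.ne']
    ring

/-- Gibbs' inequality for strictly positive distributions on a finite type. -/
theorem sum_mul_log_div_nonneg {X : Type*} [Fintype X] {p q : X → ℝ}
    (hp : ∀ x, 0 < p x) (hq : ∀ x, 0 < q x) (hsum : ∑ x, p x = ∑ x, q x) :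
    0 ≤ ∑ x, p x * Real.log (p x / q x) := by
  have hterm : ∀ x, p x - q x ≤ p x * Real.log (p x / q x) := fun x => by
    have hlog := Real.one_sub_inv_le_log_of_pos (div_pos (hp x) (hq x))
    calc p x - q x = p x * (1 - (p x / q x)⁻¹) := by
          have := (hp x).ne'
          field_simp
      _ ≤ _ := mul_le_mul_of_nonneg_left hlog (hp x).le
  calc (0 : ℝ) = ∑ x, (p x - q x) := by rw [Finset.sum_sub_distrib, hsum, sub_self]
    _ ≤ _ := Finset.sum_le_sum fun x _ => hterm x

theorem nonneg_of_forall_mul_add_sq_mul_nonneg {a b : ℝ} (hb : 0 ≤ b)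
    (h : ∀ t : ℝ, 0 < t → t < 1 → 0 ≤ t * a + t ^ 2 * b) : 0 ≤ a := by
  by_contra! ha
  have hden : 0 < b - a + 1 := by linarith
  have ht : 0 < -a / (b - a + 1) := div_pos (by linarith) hden
  have hlt : -a / (b - a + 1) < 1 := by rw [div_lt_one hden]; linarith
  have h0 := h _ ht hlt
  have heq : -a / (b - a + 1) * a + (-a / (b - a + 1)) ^ 2 * b
      = -a / (b - a + 1) * (a * (1 - a) / (b - a + 1)) := by
    field_simp
    ring
  rw [heq] at h0
  have hneg : a * (1 - a) / (b - a + 1) < 0 :=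
    div_neg_of_neg_of_pos (mul_neg_of_neg_of_pos ha (by linarith)) hden
  exact absurd h0 (not_le.mpr (mul_neg_of_pos_of_neg ht hneg))

/-- First-order optimality: if `P` minimizes the KL divergence to `N` on the half-open segment
from `P` to a measure `Q` of the same weight, then the directional derivative at `P` towards `Q`
is nonnegative. -/
theorem sum_sub_mul_log_div_nonneg {X : Type*} [Fintype X] {N P Q : X → ℝ}
    (hN : ∀ x, 0 < N x) (hP : ∀ x, 0 < P x) (hQ : ∀ x, 0 ≤ Q x)
    (hw : ∑ x, Q x = ∑ x, P x)
    (hmin : ∀ t : ℝ, 0 < t → t < 1 →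
      ∑ x, (P x * Real.log (P x / N x) + N x - P x)
        ≤ ∑ x, ((P x + t * (Q x - P x)) * Real.log ((P x + t * (Q x - P x)) / N x)
            + N x - (P x + t * (Q x - P x)))) :
    0 ≤ ∑ x, (Q x - P x) * Real.log (P x / N x) := by
  have hd : ∑ x, (Q x - P x) = 0 := by rw [Finset.sum_sub_distrib, hw, sub_self]
  refine nonneg_of_forall_mul_add_sq_mul_nonneg (b := ∑ x, (Q x - P x) ^ 2 / P x)
    (Finset.sum_nonneg fun x _ => div_nonneg (sq_nonneg _) (hP x).le) fun t ht ht1 => ?_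
  have hle : ∑ x, ((P x + t * (Q x - P x)) * Real.log ((P x + t * (Q x - P x)) / N x)
            + N x - (P x + t * (Q x - P x)))
      ≤ ∑ x, ((P x * Real.log (P x / N x) + N x - P x)
          + (t * ((Q x - P x) * Real.log (P x / N x)) + t ^ 2 * ((Q x - P x) ^ 2 / P x))) := by
    refine Finset.sum_le_sum fun x _ => ?_
    have hpos : 0 < P x + t * (Q x - P x) := by
      have h1 := mul_pos (sub_pos.mpr ht1) (hP x)
      have h2 := mul_nonneg ht.le (hQ x)
      linarith
    have hlog := mul_le_mul_of_nonneg_left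
      (Real.log_le_sub_one_of_pos (div_pos hpos (hP x))) hpos.le
    have heq : (P x + t * (Q x - P x)) * ((P x + t * (Q x - P x)) / P x - 1)
        = t * (Q x - P x) + t ^ 2 * ((Q x - P x) ^ 2 / P x) := by
      have := (hP x).ne'
      field_simp
      ring
    rw [mul_log_div_eq_add _ (hP x) (hN x)]
    linarith
  have h := (hmin t ht ht1).trans hle
  rw [Finset.sum_add_distrib, Finset.sum_add_distrib, ← Finset.mul_sum, ← Finset.mul_sum] at h
  linarith


/-- Bregman's theorem in relative-entropy terms: Let `X` be a finite set
with `|X| = m`, `ε ∈ (0,1]`, `N : X → (0,1]` a measure with strictly positive entries,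
and `M* ∈ Γ_ε` with strictly positive entries and `|M*| = εm` the exact Bregman
projection of `N` onto `Γ_ε`. Then for every measure `M_E ∈ Γ_ε` with `|M_E| = εm`:
`RE(D_{M_E}||D_N) ≥ RE(D_{M_E}||D_{M*}) + RE(D_{M*}||D_N)` and in particular
`RE(D_{M_E}||D_N) ≥ RE(D_{M_E}||D_{M*})`. -/
theorem stmt_7 {X : Type*} [Fintype X] [Nonempty X]
    (m : ℕ) (hm : Fintype.card X = m)
    (ε : ℝ) (hε : 0 < ε) (hε1 : ε ≤ 1)
    (N : X → ℝ) (hN : ∀ x, 0 < N x ∧ N x ≤ 1)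
    (Mstar : X → ℝ) (hMstar : ∀ x, 0 < Mstar x ∧ Mstar x ≤ 1)
    (hMstarw : ∑ x, Mstar x = ε * m)
    (hMstarDens : (∑ x, Mstar x) / (Fintype.card X : ℝ) ≥ ε)
    (hproj : ∀ M' : X → ℝ, (∀ x, 0 ≤ M' x ∧ M' x ≤ 1) →
      (∑ x, M' x) / (Fintype.card X : ℝ) ≥ ε →
      ∑ x, (Mstar x * Real.log (Mstar x / N x) + N x - Mstar x)
        ≤ ∑ x, (M' x * Real.log (M' x / N x) + N x - M' x)) :
    ∀ ME : X → ℝ, (∀ x, 0 ≤ ME x ∧ ME x ≤ 1) →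
      (∑ x, ME x) / (Fintype.card X : ℝ) ≥ ε →
      (∑ x, ME x = ε * m) →
      (∑ x, (ME x / ∑ y, ME y) *
          Real.log ((ME x / ∑ y, ME y) / (N x / ∑ y, N y))
        ≥ (∑ x, (ME x / ∑ y, ME y) *
            Real.log ((ME x / ∑ y, ME y) / (Mstar x / ∑ y, Mstar y)))
          + (∑ x, (Mstar x / ∑ y, Mstar y) *
              Real.log ((Mstar x / ∑ y, Mstar y) / (N x / ∑ y, N y))))
      ∧ (∑ x, (ME x / ∑ y, ME y) *
            Real.log ((ME x / ∑ y, ME y) / (N x / ∑ y, N y))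
          ≥ ∑ x, (ME x / ∑ y, ME y) *
              Real.log ((ME x / ∑ y, ME y) / (Mstar x / ∑ y, Mstar y))) := by
  intro ME hME _ hMEw
  have hX : (Finset.univ : Finset X).Nonempty := Finset.univ_nonempty
  have hP : ∀ x, 0 < Mstar x := fun x => (hMstar x).1
  have hw : ∑ x, ME x = ∑ x, Mstar x := hMEw.trans hMstarw.symm
  have hW : 0 < ∑ x, Mstar x := Finset.sum_pos (fun x _ => hP x) hX
  have hZ : 0 < ∑ x, N x := Finset.sum_pos (fun x _ => (hN x).1) hX
  have hfirst : 0 ≤ ∑ x, (ME x - Mstar x) * Real.log (Mstar x / N x) := by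
    refine sum_sub_mul_log_div_nonneg (fun x => (hN x).1) hP (fun x => (hME x).1) hw
      fun t ht ht1 => hproj _ (fun x => ?_) ?_
    · obtain ⟨hp, hp1⟩ := hMstar x
      obtain ⟨hq, hq1⟩ := hME x
      constructor <;> nlinarith
    · rwa [Finset.sum_add_distrib, ← Finset.mul_sum, Finset.sum_sub_distrib, hw, sub_self,
        mul_zero, add_zero]
  rw [hw]
  set W := ∑ x, Mstar x with hWdef
  set Z := ∑ x, N x with hZdef
  have hPW : ∀ x, 0 < Mstar x / W := fun x => div_pos (hP x) hW
  have hNZ : ∀ x, 0 < N x / Z := fun x => div_pos (hN x).1 hZ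
  have hgibbs : 0 ≤ ∑ x, Mstar x / W * Real.log (Mstar x / W / (N x / Z)) := by
    refine sum_mul_log_div_nonneg hPW hNZ ?_
    rw [← Finset.sum_div, ← Finset.sum_div, ← hWdef, ← hZdef, div_self hW.ne', div_self hZ.ne']
  have hchain : ∑ x, ME x / W * Real.log (ME x / W / (N x / Z))
      = ∑ x, ME x / W * Real.log (ME x / W / (Mstar x / W))
        + ∑ x, ME x / W * Real.log (Mstar x / W / (N x / Z)) := by
    rw [← Finset.sum_add_distrib]
    exact Finset.sum_congr rfl fun x _ => mul_log_div_eq_add _ (hPW x) (hNZ x)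
  have hdiff : ∑ x, ME x / W * Real.log (Mstar x / W / (N x / Z))
      - ∑ x, Mstar x / W * Real.log (Mstar x / W / (N x / Z))
      = (∑ x, (ME x - Mstar x) * Real.log (Mstar x / N x)) / W := by
    have hd : ∑ x, (ME x - Mstar x) * (Real.log (Z / W) / W) = 0 := by
      rw [← Finset.sum_mul, Finset.sum_sub_distrib, hw, sub_self, zero_mul]
    rw [← Finset.sum_sub_distrib, ← add_zero (_ / W), ← hd, Finset.sum_div,
      ← Finset.sum_add_distrib]
    refine Finset.sum_congr rfl fun x _ => ?_
    have hsplit : Real.log (Mstar x / W / (N x / Z))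
        = Real.log (Mstar x / N x) + Real.log (Z / W) := by
      rw [← Real.log_mul (div_pos (hP x) (hN x).1).ne' (div_pos hZ hW).ne', div_div_div_eq,
        div_mul_div_comm, mul_comm W]
    rw [hsplit]
    ring
  have hnonneg := div_nonneg hfirst hW.le
  constructor <;> linarith
end

section
/- Let X be a finite set with |X| = m, and let ε, ζ ∈ (0,1). Let N : X → (0,1] be a measure with strictly positive entries, let M* ∈ Γ_ε with strictly positive entries and |M*| = εm be the exact Bregman projection of N onto Γ_ε (i.e., KL(M*||N) ≤ KL(M'||N) for all M' ∈ Γ_ε), and let M̃ : X → [0,1] have strictly positive entries with |M̃| ≥ εm. If for every measure M_E ∈ Γ_ε with |M_E| = εm it holds that KL(M_E||M̃) ≤ KL(M_E||M*) + ζεm, then for every such M_E: RE(D_{M_E}||D_{M̃}) ≤ RE(D_{M_E}||D_N) + ζ, where D_M = M/|M| denotes the normalized distribution of a measure M. -/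
/-- First-order optimality for minimisers of the relative entropy with respect to `N`. -/
theorem sum_mul_log_div_le_of_projection {X : Type*} [Fintype X] {N P Q : X → ℝ}
    (hN : ∀ x, 0 < N x) (hP : ∀ x, 0 < P x) (hQ : ∀ x, 0 ≤ Q x)
    (hPQ : ∑ x, Q x = ∑ x, P x)
    (hmin : ∀ t : ℝ, 0 < t → t < 1 →
      ∑ x, P x * Real.log (P x / N x) ≤
        ∑ x, (P x + t * (Q x - P x)) * Real.log ((P x + t * (Q x - P x)) / N x)) :
    ∑ x, P x * Real.log (P x / N x) ≤ ∑ x, Q x * Real.log (P x / N x) := by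
  set C := ∑ x, (Q x - P x) ^ 2 / P x
  set A := ∑ x, (Q x - P x) * Real.log (P x / N x) with hA
  have hAeq : A = ∑ x, Q x * Real.log (P x / N x) - ∑ x, P x * Real.log (P x / N x) := by
    rw [hA, ← Finset.sum_sub_distrib]
    exact Finset.sum_congr rfl fun x _ => by ring
  have hC : 0 ≤ C := Finset.sum_nonneg fun x _ => div_nonneg (sq_nonneg _) (hP x).le
  have key : ∀ t : ℝ, 0 < t → t < 1 → 0 ≤ A + t * C := by
    intro t ht ht1
    have hterm : ∀ x, (P x + t * (Q x - P x)) * Real.log ((P x + t * (Q x - P x)) / N x) ≤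
        P x * Real.log (P x / N x) + t * ((Q x - P x) * Real.log (P x / N x)) +
          t * (Q x - P x) + t ^ 2 * ((Q x - P x) ^ 2 / P x) := by
      intro x
      have hp := hP x
      have hR : 0 < P x + t * (Q x - P x) := by nlinarith [hQ x]
      have hlog := Real.log_le_sub_one_of_pos (div_pos hR hp)
      have hmul := mul_le_mul_of_nonneg_left hlog hR.le
      rw [Real.log_div hR.ne' hp.ne'] at hmul
      rw [Real.log_div hR.ne' (hN x).ne', Real.log_div hp.ne' (hN x).ne']
      have hq : (P x + t * (Q x - P x)) * ((P x + t * (Q x - P x)) / P x - 1) =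
          t * (Q x - P x) + t ^ 2 * ((Q x - P x) ^ 2 / P x) := by
        field_simp
        ring
      linarith
    have hsum := (hmin t ht ht1).trans (Finset.sum_le_sum fun x _ => hterm x)
    simp only [Finset.sum_add_distrib, ← Finset.mul_sum, Finset.sum_sub_distrib, hPQ] at hsum
    have : 0 ≤ t * (A + t * C) := by
      have h' : 0 ≤ t * A + t ^ 2 * C := by linarith
      linarith
    exact nonneg_of_mul_nonneg_right this ht
  suffices 0 ≤ A by linarith
  by_contra! hneg
  have hd : 0 < C - A + 1 := by linarith
  have h := key (-A / (C - A + 1)) (by apply div_pos <;> linarith)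
    (by rw [div_lt_one hd]; linarith)
  have h2 : A + -A / (C - A + 1) * C = A * (1 - A) / (C - A + 1) := by
    field_simp
    ring
  rw [h2] at h
  have : A * (1 - A) / (C - A + 1) < 0 :=
    div_neg_of_neg_of_pos (mul_neg_of_neg_of_pos hneg (by linarith)) hd
  linarith

/-- The log-sum inequality. -/
theorem neg_mul_log_le_sum_mul_log_div {X : Type*} [Fintype X] [Nonempty X] {P N : X → ℝ}
    (hP : ∀ x, 0 < P x) (hN : ∀ x, 0 < N x) :
    -((∑ x, P x) * Real.log ((∑ x, N x) / ∑ x, P x)) ≤ ∑ x, P x * Real.log (P x / N x) := by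
  set W := ∑ x, P x with hW
  set n := ∑ x, N x with hn
  have hWpos : 0 < W := Finset.sum_pos (fun x _ => hP x) Finset.univ_nonempty
  have hnpos : 0 < n := Finset.sum_pos (fun x _ => hN x) Finset.univ_nonempty
  have hterm : ∀ x, P x - N x * (W / n) - P x * Real.log (n / W) ≤
      P x * Real.log (P x / N x) := by
    intro x
    have hp := hP x
    have hx := hN x
    have hlog := mul_le_mul_of_nonneg_left
      (Real.log_le_sub_one_of_pos (div_pos (mul_pos hx hWpos) (mul_pos hp hnpos))) hp.le
    rw [Real.log_div (mul_pos hx hWpos).ne' (mul_pos hp hnpos).ne',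
      Real.log_mul hx.ne' hWpos.ne', Real.log_mul hp.ne' hnpos.ne'] at hlog
    rw [Real.log_div hnpos.ne' hWpos.ne', Real.log_div hp.ne' hx.ne']
    have hq : P x * (N x * W / (P x * n) - 1) = N x * (W / n) - P x := by
      field_simp
    linarith
  have hsum := Finset.sum_le_sum fun x (_ : x ∈ Finset.univ) => hterm x
  simp only [Finset.sum_sub_distrib, ← Finset.sum_mul, ← hW, ← hn] at hsum
  rw [mul_div_cancel₀ W hnpos.ne'] at hsum
  linarith

/-- The relative entropy of normalised measures in terms of the measures themselves. -/
theorem sum_normalized_mul_log {X : Type*} [Fintype X] [Nonempty X] {Q N : X → ℝ}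
    (hQ : ∀ x, 0 ≤ Q x) (hN : ∀ x, 0 < N x) (hW : 0 < ∑ x, Q x) :
    ∑ x, (Q x / ∑ y, Q y) * Real.log ((Q x / ∑ y, Q y) / (N x / ∑ y, N y)) =
      (∑ x, Q x * Real.log (Q x / N x)) / (∑ x, Q x) +
        Real.log ((∑ x, N x) / ∑ x, Q x) := by
  set W := ∑ x, Q x with hWdef
  set n := ∑ x, N x
  have hn : 0 < n := Finset.sum_pos (fun x _ => hN x) Finset.univ_nonempty
  have hterm : ∀ x, (Q x / W) * Real.log ((Q x / W) / (N x / n)) =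
      Q x * Real.log (Q x / N x) / W + Q x / W * Real.log (n / W) := by
    intro x
    rcases (hQ x).eq_or_lt with h | h
    · simp [← h]
    · rw [show (Q x / W) / (N x / n) = (Q x / N x) * (n / W) by
          have := (hN x).ne'
          field_simp,
        Real.log_mul (div_pos h (hN x)).ne' (div_pos hn hW).ne']
      ring
  rw [Finset.sum_congr rfl fun x _ => hterm x, Finset.sum_add_distrib, ← Finset.sum_div,
    ← Finset.sum_mul, ← Finset.sum_div, ← hWdef, div_self hW.ne', one_mul]

/-- Let `X` be a finite set with `|X| = m`, `ε, ζ ∈ (0,1)`, `N : X → (0,1]`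
a measure with strictly positive entries, `M* ∈ Γ_ε` with strictly positive entries and
`|M*| = εm` the exact Bregman projection of `N` onto `Γ_ε`, and `M̃ : X → (0,1]` with
`|M̃| ≥ εm`. If `KL(M_E||M̃) ≤ KL(M_E||M*) + ζεm` for every `M_E ∈ Γ_ε` with
`|M_E| = εm`, then for every such `M_E`: `RE(D_{M_E}||D_{M̃}) ≤ RE(D_{M_E}||D_N) + ζ`. -/
theorem stmt_8 {X : Type*} [Fintype X] [Nonempty X]
    (m : ℕ) (hm : Fintype.card X = m)
    (ε ζ : ℝ) (hε : 0 < ε) (hε1 : ε < 1) (hζ : 0 < ζ) (hζ1 : ζ < 1)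
    (N : X → ℝ) (hN : ∀ x, 0 < N x ∧ N x ≤ 1)
    (Mstar : X → ℝ) (hMstar : ∀ x, 0 < Mstar x ∧ Mstar x ≤ 1)
    (hMstarw : ∑ x, Mstar x = ε * m)
    (hMstarDens : (∑ x, Mstar x) / (Fintype.card X : ℝ) ≥ ε)
    (hproj : ∀ M' : X → ℝ, (∀ x, 0 ≤ M' x ∧ M' x ≤ 1) →
      (∑ x, M' x) / (Fintype.card X : ℝ) ≥ ε →
      ∑ x, (Mstar x * Real.log (Mstar x / N x) + N x - Mstar x)
        ≤ ∑ x, (M' x * Real.log (M' x / N x) + N x - M' x))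
    (Mt : X → ℝ) (hMt : ∀ x, 0 < Mt x ∧ Mt x ≤ 1)
    (hMtw : ∑ x, Mt x ≥ ε * m)
    (happrox : ∀ ME : X → ℝ, (∀ x, 0 ≤ ME x ∧ ME x ≤ 1) →
      (∑ x, ME x) / (Fintype.card X : ℝ) ≥ ε → (∑ x, ME x = ε * m) →
      ∑ x, (ME x * Real.log (ME x / Mt x) + Mt x - ME x)
        ≤ (∑ x, (ME x * Real.log (ME x / Mstar x) + Mstar x - ME x)) + ζ * ε * m) :
    ∀ ME : X → ℝ, (∀ x, 0 ≤ ME x ∧ ME x ≤ 1) →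
      (∑ x, ME x) / (Fintype.card X : ℝ) ≥ ε → (∑ x, ME x = ε * m) →
      ∑ x, (ME x / ∑ y, ME y) *
          Real.log ((ME x / ∑ y, ME y) / (Mt x / ∑ y, Mt y))
        ≤ (∑ x, (ME x / ∑ y, ME y) *
            Real.log ((ME x / ∑ y, ME y) / (N x / ∑ y, N y))) + ζ := by
  intro ME hME hdens hw
  subst hm
  have hcard : (0 : ℝ) < Fintype.card X := by exact_mod_cast Fintype.card_pos
  have hWpos : 0 < ε * (Fintype.card X : ℝ) := mul_pos hε hcard
  have hmin : ∑ x, Mstar x * Real.log (Mstar x / N x) ≤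
      ∑ x, ME x * Real.log (Mstar x / N x) := by
    refine sum_mul_log_div_le_of_projection (fun x => (hN x).1) (fun x => (hMstar x).1)
      (fun x => (hME x).1) (hw.trans hMstarw.symm) fun t ht ht1 => ?_
    have hsum : ∑ x, (Mstar x + t * (ME x - Mstar x)) = ε * (Fintype.card X : ℝ) := by
      rw [Finset.sum_add_distrib, ← Finset.mul_sum, Finset.sum_sub_distrib, hw, hMstarw]
      ring
    have h := hproj (fun x => Mstar x + t * (ME x - Mstar x))
      (fun x => by
        constructor
        · nlinarith [(hMstar x).1, (hME x).1]
        · nlinarith [(hMstar x).2, (hME x).2])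
      (by rw [hsum, ← hMstarw]; exact hMstarDens)
    simp only [Finset.sum_sub_distrib, Finset.sum_add_distrib (g := N)] at h
    rw [hsum, hMstarw] at h
    linarith
  have hlogsum := neg_mul_log_le_sum_mul_log_div (fun x => (hMstar x).1) (fun x => (hN x).1)
  have hsplit : ∑ x, ME x * Real.log (ME x / N x) =
      ∑ x, ME x * Real.log (ME x / Mstar x) + ∑ x, ME x * Real.log (Mstar x / N x) := by
    rw [← Finset.sum_add_distrib]
    refine Finset.sum_congr rfl fun x _ => ?_
    rcases (hME x).1.eq_or_lt with h | h
    · simp [← h]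
    · rw [Real.log_div h.ne' (hN x).1.ne', Real.log_div h.ne' (hMstar x).1.ne',
        Real.log_div (hMstar x).1.ne' (hN x).1.ne']
      ring
  have happ := happrox ME hME hdens hw
  simp only [Finset.sum_sub_distrib, Finset.sum_add_distrib] at happ
  rw [sum_normalized_mul_log (fun x => (hME x).1) (fun x => (hMt x).1) (by rwa [hw]),
    sum_normalized_mul_log (fun x => (hME x).1) (fun x => (hN x).1) (by rwa [hw])]
  rw [hMstarw] at hlogsum happ
  rw [hw] at happ ⊢
  set W := ε * (Fintype.card X : ℝ) with hW
  have hlog := mul_le_mul_of_nonneg_left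
    (Real.log_le_sub_one_of_pos (div_pos (hWpos.trans_le hMtw) hWpos)) hWpos.le
  rw [mul_sub, mul_div_cancel₀ _ hWpos.ne', mul_one] at hlog
  have hζW : ζ * ε * (Fintype.card X : ℝ) = ζ * W := by rw [hW]; ring
  rw [← mul_le_mul_iff_of_pos_left hWpos]
  simp only [mul_add, mul_div_cancel₀ _ hWpos.ne']
  linarith
end

section
/- Let X be a finite set, γ ∈ (0,1/2], ℓ : X → {0,1} a Boolean loss vector, and D^t a probability distribution on X with D^t(x) > 0 for all x. Define the multiplicatively updated distribution D̂(x) = D^t(x)(1−γ)^{ℓ(x)}/Z with normalization Z = ∑_x D^t(x)(1−γ)^{ℓ(x)} = 1 − γ⟨D^t,ℓ⟩. Then for every probability distribution D on X: RE(D||D̂) − RE(D||D^t) = log(Z) − ⟨D,ℓ⟩·log(1−γ) ≤ γ·((1+γ)⟨D,ℓ⟩ − ⟨D^t,ℓ⟩), where ⟨D,ℓ⟩ = ∑_x D(x)ℓ(x). -/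
/-- A quadratic upper bound for `-log (1 - x)` on `[0, 1/2]`. -/
theorem neg_log_one_sub_le_add_sq {x : ℝ} (hx : 0 ≤ x) (hx2 : x ≤ 1 / 2) :
    -Real.log (1 - x) ≤ x + x ^ 2 := by
  have h := Real.abs_log_sub_add_sum_range_le (x := x) (by rw [abs_of_nonneg hx]; linarith) 4
  rw [abs_of_nonneg hx] at h
  have hlog := (abs_le.mp h).1
  norm_num [Finset.sum_range_succ] at hlog
  have htail : x ^ 5 / (1 - x) ≤ 2 * x ^ 5 := by
    rw [div_le_iff₀ (by linarith)]
    nlinarith [pow_nonneg hx 5]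
  have hsq : x ^ 2 ≤ 1 / 4 := by nlinarith
  have hcube : x ^ 3 ≤ 1 / 8 := by nlinarith
  have hpoly : 0 ≤ x ^ 2 * (1 / 2 - x / 3 - x ^ 2 / 4 - 2 * x ^ 3) :=
    mul_nonneg (sq_nonneg x) (by linarith)
  linarith


/-- Multiplicative-update potential change: Let `X` be a finite set,
`γ ∈ (0,1/2]`, `ℓ : X → {0,1}` a Boolean loss vector, and `D^t` a strictly positive
probability distribution on `X`. Define `D̂(x) = D^t(x)(1−γ)^{ℓ(x)}/Z` with
`Z = ∑_x D^t(x)(1−γ)^{ℓ(x)} = 1 − γ⟨D^t,ℓ⟩`. Then for every probability distribution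
`D` on `X`: `RE(D||D̂) − RE(D||D^t) = log Z − ⟨D,ℓ⟩·log(1−γ)
  ≤ γ·((1+γ)⟨D,ℓ⟩ − ⟨D^t,ℓ⟩)`. -/
theorem stmt_9 {X : Type*} [Fintype X] [Nonempty X]
    (γ : ℝ) (hγ : 0 < γ) (hγ2 : γ ≤ 1 / 2)
    (ℓ : X → ℕ) (hℓ : ∀ x, ℓ x ≤ 1)
    (Dt : X → ℝ) (hDtpos : ∀ x, 0 < Dt x) (hDtsum : ∑ x, Dt x = 1)
    (Z : ℝ) (hZ : Z = ∑ x, Dt x * (1 - γ) ^ (ℓ x))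
    (hZ' : Z = 1 - γ * ∑ x, Dt x * (ℓ x : ℝ))
    (Dhat : X → ℝ) (hDhat : ∀ x, Dhat x = Dt x * (1 - γ) ^ (ℓ x) / Z) :
    ∀ D : X → ℝ, (∀ x, 0 ≤ D x) → (∑ x, D x = 1) →
      ((∑ x, D x * Real.log (D x / Dhat x)) - (∑ x, D x * Real.log (D x / Dt x))
          = Real.log Z - (∑ x, D x * (ℓ x : ℝ)) * Real.log (1 - γ))
      ∧ ((∑ x, D x * Real.log (D x / Dhat x)) - (∑ x, D x * Real.log (D x / Dt x))
          ≤ γ * ((1 + γ) * (∑ x, D x * (ℓ x : ℝ)) - ∑ x, Dt x * (ℓ x : ℝ))) := by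
  intro D hD hDsum
  have hγ1 : 0 < 1 - γ := by linarith
  have hZpos : 0 < Z := by
    rw [hZ]
    exact Finset.sum_pos (fun x _ => mul_pos (hDtpos x) (pow_pos hγ1 _)) Finset.univ_nonempty
  have hterm : ∀ x, D x * Real.log (D x / Dhat x) - D x * Real.log (D x / Dt x)
      = D x * Real.log Z - D x * (ℓ x : ℝ) * Real.log (1 - γ) := by
    intro x
    rcases (hD x).eq_or_lt with h | h
    · simp [← h]
    · have hpow := pow_pos hγ1 (ℓ x)
      have hnum := mul_pos (hDtpos x) hpow
      rw [hDhat, Real.log_div h.ne' (div_pos hnum hZpos).ne', Real.log_div hnum.ne' hZpos.ne',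
        Real.log_mul (hDtpos x).ne' hpow.ne', Real.log_pow, Real.log_div h.ne' (hDtpos x).ne']
      ring
  have heq : (∑ x, D x * Real.log (D x / Dhat x)) - (∑ x, D x * Real.log (D x / Dt x))
      = Real.log Z - (∑ x, D x * (ℓ x : ℝ)) * Real.log (1 - γ) := by
    rw [← Finset.sum_sub_distrib, Finset.sum_congr rfl fun x _ => hterm x,
      Finset.sum_sub_distrib, ← Finset.sum_mul, ← Finset.sum_mul, hDsum, one_mul]
  refine ⟨heq, ?_⟩
  rw [heq]
  have hlogZ := Real.log_le_sub_one_of_pos hZpos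
  have hloss : 0 ≤ ∑ x, D x * (ℓ x : ℝ) :=
    Finset.sum_nonneg fun x _ => mul_nonneg (hD x) (Nat.cast_nonneg _)
  have hmul := mul_le_mul_of_nonneg_left (neg_log_one_sub_le_add_sq hγ.le hγ2) hloss
  linarith
end

section
/- (Empirical error bound for QuantumBoost.) Let m and T be positive integers, ε ∈ (0,1), γ ∈ (0,1/2], and ζ ≥ 0. Let ℓ^1,…,ℓ^T : {1,…,m} → {0,1} be Boolean loss vectors and D^1,…,D^{T+1} probability distributions on {1,…,m} with strictly positive entries, where D^1 is the uniform distribution. For each t, let D̂^{t+1}(i) = D^t(i)(1−γ)^{ℓ^t(i)}/Z_t with Z_t = 1 − γ⟨D^t,ℓ^t⟩ be the multiplicative update of D^t, and let P ⊆ {1,…,T} with |P| = R be a set of projection rounds such that: for t ∉ P, D^{t+1} = D̂^{t+1}; and for t ∈ P, RE(D||D^{t+1}) ≤ RE(D||D̂^{t+1}) + ζ for every ε-smooth distribution D. Assume the weak-learning condition ⟨D^t, ℓ^t⟩ ≥ 1/2 + γ for every t, that Rζ ≤ Tγ²/4, and that T > 4·log(1/ε)/γ². Then the set E = {i ∈ {1,…,m}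 : ∑_{t=1}^T ℓ^t(i) ≤ T/2} of points misclassified by the majority vote satisfies |E| < εm. -/
open Finset in
theorem relEntropy_nonneg {ι : Type*} [Fintype ι] {U D : ι → ℝ} (hU : ∀ i, 0 ≤ U i)
    (hD : ∀ i, 0 < D i) (hUsum : ∑ i, U i = 1) (hDsum : ∑ i, D i = 1) :
    0 ≤ ∑ i, U i * Real.log (U i / D i) := by
  have h : ∀ i, U i - D i ≤ U i * Real.log (U i / D i) := by
    intro i
    rcases (hU i).eq_or_lt with h0 | h0
    · simp [← h0, (hD i).le]
    · have h1 := Real.one_sub_inv_le_log_of_pos (div_pos h0 (hD i))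
      have h2 := mul_le_mul_of_nonneg_left h1 h0.le
      have h3 : U i * (1 - (U i / D i)⁻¹) = U i - D i := by
        have := (hD i).ne'
        field_simp
      linarith
  have h1 := sum_le_sum fun i (_ : i ∈ univ) => h i
  rw [sum_sub_distrib, hUsum, hDsum] at h1
  linarith

/-- The change of relative entropy under a multiplicative weights update. -/
theorem relEntropy_mul_update {ι : Type*} [Fintype ι] {U D : ι → ℝ} (hU : ∀ i, 0 ≤ U i)
    (hD : ∀ i, 0 < D i) (hUsum : ∑ i, U i = 1) {γ Z : ℝ} (hγ : γ < 1) (hZ : 0 < Z) (ℓ : ι → ℕ) :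
    ∑ i, U i * Real.log (U i / (D i * (1 - γ) ^ ℓ i / Z))
      = ∑ i, U i * Real.log (U i / D i) + Real.log Z
        + -Real.log (1 - γ) * ∑ i, U i * (ℓ i : ℝ) := by
  have h : ∀ i, U i * Real.log (U i / (D i * (1 - γ) ^ ℓ i / Z))
      = U i * Real.log (U i / D i) + U i * Real.log Z
        + -Real.log (1 - γ) * (U i * (ℓ i : ℝ)) := by
    intro i
    rcases (hU i).eq_or_lt with h0 | h0
    · simp [← h0]
    · have hp : 0 < (1 - γ) ^ ℓ i := pow_pos (by linarith) _
      have hDi := hD i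
      rw [Real.log_div h0.ne' (by positivity), Real.log_div (by positivity) hZ.ne',
        Real.log_mul hDi.ne' hp.ne', Real.log_pow, Real.log_div h0.ne' hDi.ne']
      ring
  simp_rw [h]
  rw [Finset.sum_add_distrib, Finset.sum_add_distrib, ← Finset.sum_mul, hUsum, ← Finset.mul_sum,
    one_mul]

theorem le_add_sum_Icc_of_succ_le {f g : ℕ → ℝ} (n : ℕ)
    (h : ∀ t ∈ Finset.Icc 1 n, f (t + 1) ≤ f t + g t) :
    f (n + 1) ≤ f 1 + ∑ t ∈ Finset.Icc 1 n, g t := by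
  induction n with
  | zero => simp
  | succ n ih =>
    rw [Finset.sum_Icc_succ_top (by omega)]
    have h1 := ih fun t ht => h t (by simp at ht ⊢; omega)
    have h2 := h (n + 1) (by simp)
    linarith


/-- Empirical error bound for QuantumBoost: Under multiplicative updates
with lazy approximate projections (costing at most `ζ` per projection round against any
`ε`-smooth distribution), with `D^1` uniform, the weak-learning condition
`⟨D^t,ℓ^t⟩ ≥ 1/2 + γ`, `Rζ ≤ Tγ²/4` and `T > 4·log(1/ε)/γ²`, the set
`E = {i : ∑_t ℓ^t(i) ≤ T/2}` of points misclassified by the majority vote satisfies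
`|E| < εm`. -/
theorem stmt_11
    (m T : ℕ) (hm : 0 < m) (hT : 0 < T)
    (ε γ ζ : ℝ) (hε : 0 < ε) (hε1 : ε < 1) (hγ : 0 < γ) (hγ2 : γ ≤ 1 / 2) (hζ : 0 ≤ ζ)
    (ℓ : ℕ → Fin m → ℕ) (hℓ : ∀ t i, ℓ t i ≤ 1)
    (D : ℕ → Fin m → ℝ)
    (hDpos : ∀ t ∈ Finset.Icc 1 (T + 1), ∀ i, 0 < D t i)
    (hDsum : ∀ t ∈ Finset.Icc 1 (T + 1), ∑ i, D t i = 1)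
    (hD1 : ∀ i, D 1 i = 1 / m)
    (Dhat : ℕ → Fin m → ℝ)
    (hDhat : ∀ t ∈ Finset.Icc 1 T, ∀ i,
      Dhat (t + 1) i = D t i * (1 - γ) ^ (ℓ t i)
        / (1 - γ * ∑ j, D t j * (ℓ t j : ℝ)))
    (P : Finset ℕ) (hP : P ⊆ Finset.Icc 1 T) (R : ℕ) (hR : P.card = R)
    (hnoproj : ∀ t ∈ Finset.Icc 1 T, t ∉ P → D (t + 1) = Dhat (t + 1))
    (hproj : ∀ t ∈ Finset.Icc 1 T, t ∈ P →
      ∀ Dsm : Fin m → ℝ, (∀ i, 0 ≤ Dsm i) → (∑ i, Dsm i = 1) →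
        (∀ i, Dsm i ≤ 1 / (ε * m)) →
        ∑ i, Dsm i * Real.log (Dsm i / D (t + 1) i)
          ≤ (∑ i, Dsm i * Real.log (Dsm i / Dhat (t + 1) i)) + ζ)
    (hweak : ∀ t ∈ Finset.Icc 1 T, ∑ i, D t i * (ℓ t i : ℝ) ≥ 1 / 2 + γ)
    (hRζ : (R : ℝ) * ζ ≤ T * γ ^ 2 / 4)
    (hTlarge : (T : ℝ) > 4 * Real.log (1 / ε) / γ ^ 2) :
    ((Finset.univ.filter
        (fun i : Fin m => (∑ t ∈ Finset.Icc 1 T, (ℓ t i : ℝ)) ≤ T / 2)).card : ℝ)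
      < ε * m := by
  set E := Finset.univ.filter
    (fun i : Fin m => (∑ t ∈ Finset.Icc 1 T, (ℓ t i : ℝ)) ≤ T / 2) with hE
  by_contra! hlarge
  have hm' : (0 : ℝ) < m := by exact_mod_cast hm
  have hεm : 0 < ε * m := by positivity
  have hk : (0 : ℝ) < E.card := hεm.trans_le hlarge
  set U : Fin m → ℝ := fun i => if i ∈ E then 1 / (E.card : ℝ) else 0 with hUdef
  have hUsum_mul : ∀ f : Fin m → ℝ, ∑ i, U i * f i = 1 / E.card * ∑ i ∈ E, f i := by
    intro f
    simp [hUdef, ite_mul, Finset.sum_ite_mem, Finset.mul_sum]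
  have hU0 : ∀ i, 0 ≤ U i := by
    intro i
    simp only [hUdef]
    split_ifs <;> positivity
  have hU1 : ∑ i, U i = 1 := by
    have := hUsum_mul fun _ => 1
    simpa [hk.ne'] using this
  have hUsmooth : ∀ i, U i ≤ 1 / (ε * m) := by
    intro i
    simp only [hUdef]
    split_ifs
    · gcongr
    · positivity
  have hUinit : ∑ i, U i * Real.log (U i / D 1 i) ≤ Real.log (1 / ε) := by
    have hpt : ∀ i, U i * Real.log (U i / D 1 i) ≤ U i * Real.log (1 / ε) := by
      intro i
      rcases (hU0 i).eq_or_lt with h0 | h0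
      · simp [← h0]
      · refine mul_le_mul_of_nonneg_left (Real.log_le_log ?_ ?_) h0.le
        · rw [hD1]
          positivity
        · rw [hD1, div_le_iff₀ (by positivity)]
          refine (hUsmooth i).trans_eq ?_
          field_simp
    calc _ ≤ ∑ i, U i * Real.log (1 / ε) := Finset.sum_le_sum fun i _ => hpt i
      _ = _ := by rw [← Finset.sum_mul, hU1, one_mul]
  have hstep : ∀ t ∈ Finset.Icc 1 T,
      ∑ i, U i * Real.log (U i / D (t + 1) i) ≤ ∑ i, U i * Real.log (U i / D t i)
        + (-(γ * (1 / 2 + γ)) + -Real.log (1 - γ) * ∑ i, U i * (ℓ t i : ℝ)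
          + if t ∈ P then ζ else 0) := by
    intro t ht
    have ht' : t ∈ Finset.Icc 1 (T + 1) := by simp at ht ⊢; omega
    have hedge : ∑ j, D t j * (ℓ t j : ℝ) ≤ 1 := by
      rw [← hDsum t ht']
      refine Finset.sum_le_sum fun i _ => mul_le_of_le_one_right (hDpos t ht' i).le ?_
      exact_mod_cast hℓ t i
    have hZ : 0 < 1 - γ * ∑ j, D t j * (ℓ t j : ℝ) := by nlinarith
    have hlogZ := Real.log_le_sub_one_of_pos hZ
    have hw := mul_le_mul_of_nonneg_left (hweak t ht) hγ.le
    have hupd := relEntropy_mul_update hU0 (hDpos t ht') hU1 (by linarith : γ < 1) hZ (ℓ t)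
    simp_rw [← hDhat t ht] at hupd
    split_ifs with htP
    · have := hproj t ht htP U hU0 hU1 hUsmooth
      linarith
    · rw [hnoproj t ht htP]
      linarith
  have htotal := le_add_sum_Icc_of_succ_le
    (f := fun t => ∑ i, U i * Real.log (U i / D t i)) T hstep
  have hfinal : 0 ≤ ∑ i, U i * Real.log (U i / D (T + 1) i) :=
    relEntropy_nonneg hU0 (hDpos _ (by simp)) hU1 (hDsum _ (by simp))
  have hloss : ∑ t ∈ Finset.Icc 1 T, ∑ i, U i * (ℓ t i : ℝ) ≤ T / 2 := by
    rw [Finset.sum_comm]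
    simp_rw [← Finset.mul_sum]
    rw [hUsum_mul, one_div, inv_mul_le_iff₀ hk]
    refine (Finset.sum_le_card_nsmul E _ ((T : ℝ) / 2) fun i hi => ?_).trans_eq (nsmul_eq_mul _ _)
    exact (Finset.mem_filter.1 hi).2
  have hcost : ∑ t ∈ Finset.Icc 1 T, (if t ∈ P then ζ else 0) = R * ζ := by
    rw [Finset.sum_ite_mem, Finset.inter_eq_right.2 hP, Finset.sum_const, hR, nsmul_eq_mul]
  rw [Finset.sum_add_distrib, Finset.sum_add_distrib, ← Finset.mul_sum, hcost, Finset.sum_const,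
    Nat.card_Icc, Nat.add_sub_cancel, nsmul_eq_mul] at htotal
  have hlog : -Real.log (1 - γ) ≤ γ + γ ^ 2 := neg_log_one_sub_le_add_sq hγ.le hγ2
  have hlog0 : 0 ≤ -Real.log (1 - γ) :=
    neg_nonneg.2 (Real.log_nonpos (by linarith) (by linarith))
  have hdrift := mul_le_mul_of_nonneg_left hloss hlog0
  have hdrift' := mul_le_mul_of_nonneg_right hlog (by positivity : (0 : ℝ) ≤ T / 2)
  rw [gt_iff_lt, div_lt_iff₀ (by positivity)] at hTlarge
  have hring : (T : ℝ) * -(γ * (1 / 2 + γ)) + (γ + γ ^ 2) * (T / 2) = -(T * γ ^ 2 / 2) := by ring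
  linarith
end

section
/- Let X be a finite set with |X| = m, ε ∈ (0,1], and ζ ∈ (0,1). Let N : X → (0,1] be a measure with strictly positive entries, and let c ≥ 1 be the smallest constant such that M* = min(1, c·N) has density μ(M*) = ε (so that M* is the exact Bregman projection of N onto Γ_ε). Suppose c̃ ≥ 1 is such that the measure M̃ = min(1, c̃·N) satisfies ε ≤ μ(M̃) ≤ (1+ζ)ε. Then M̃ is a ζεm-approximation of M*: M̃ ∈ Γ_ε, and KL(M||M̃) ≤ KL(M||M*) + ζεm for every measure M ∈ Γ_ε. -/
/-- Let `X` be a finite set with `|X| = m`, `ε ∈ (0,1]`, `ζ ∈ (0,1)`, and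
`N : X → (0,1]` a measure with strictly positive entries. Let `c ≥ 1` be the smallest
constant such that `M* = min(1, c·N)` has density `ε` (so `M*` is the exact Bregman
projection of `N` onto `Γ_ε`). If `c̃ ≥ 1` is such that `M̃ = min(1, c̃·N)` satisfies
`ε ≤ μ(M̃) ≤ (1+ζ)ε`, then `M̃` is a `ζεm`-approximation of `M*`: `M̃ ∈ Γ_ε` and
`KL(M||M̃) ≤ KL(M||M*) + ζεm` for every measure `M ∈ Γ_ε`. -/
theorem stmt_12 {X : Type*} [Fintype X] [Nonempty X]
    (m : ℕ) (hm : Fintype.card X = m)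
    (ε ζ : ℝ) (hε : 0 < ε) (hε1 : ε ≤ 1) (hζ : 0 < ζ) (hζ1 : ζ < 1)
    (N : X → ℝ) (hN : ∀ x, 0 < N x ∧ N x ≤ 1)
    (c : ℝ) (hc : 1 ≤ c)
    (hdens : (∑ x, min 1 (c * N x)) / (Fintype.card X : ℝ) = ε)
    (hmin : ∀ c', 1 ≤ c' → c' < c →
      (∑ x, min 1 (c' * N x)) / (Fintype.card X : ℝ) ≠ ε)
    (ctil : ℝ) (hctil : 1 ≤ ctil)
    (hlow : ε ≤ (∑ x, min 1 (ctil * N x)) / (Fintype.card X : ℝ))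
    (hhigh : (∑ x, min 1 (ctil * N x)) / (Fintype.card X : ℝ) ≤ (1 + ζ) * ε) :
    ((∑ x, min 1 (ctil * N x)) / (Fintype.card X : ℝ) ≥ ε)
    ∧ ∀ M : X → ℝ, (∀ x, 0 ≤ M x ∧ M x ≤ 1) →
        (∑ x, M x) / (Fintype.card X : ℝ) ≥ ε →
        ∑ x, (M x * Real.log (M x / min 1 (ctil * N x))
            + min 1 (ctil * N x) - M x)
          ≤ (∑ x, (M x * Real.log (M x / min 1 (c * N x))
              + min 1 (c * N x) - M x)) + ζ * ε * m := by
  have hcard : (0 : ℝ) < Fintype.card X := by exact_mod_cast Fintype.card_pos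
  have hcc : c ≤ ctil := by
    by_contra! hlt
    refine hmin ctil hctil hlt (le_antisymm ?_ hlow)
    rw [← hdens]
    gcongr with x _
    exact (hN x).1.le
  refine ⟨hlow, fun M hM _ => ?_⟩
  have hle : ∀ x, min 1 (c * N x) ≤ min 1 (ctil * N x) := fun x =>
    min_le_min_left 1 (mul_le_mul_of_nonneg_right hcc (hN x).1.le)
  have hpos : ∀ x, 0 < min 1 (c * N x) := fun x =>
    lt_min one_pos (mul_pos (by linarith) (hN x).1)
  have hlog : ∑ x, M x * Real.log (M x / min 1 (ctil * N x))
      ≤ ∑ x, M x * Real.log (M x / min 1 (c * N x)) := by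
    refine Finset.sum_le_sum fun x _ => ?_
    rcases (hM x).1.eq_or_lt with h0 | h0
    · simp [← h0]
    · exact mul_le_mul_of_nonneg_left
        (Real.log_le_log (div_pos h0 ((hpos x).trans_le (hle x)))
          (div_le_div_of_nonneg_left h0.le (hpos x) (hle x))) h0.le
  rw [div_le_iff₀ hcard] at hhigh
  rw [div_eq_iff hcard.ne'] at hdens
  simp only [Finset.sum_sub_distrib, Finset.sum_add_distrib]
  rw [← hm]
  linarith
end

section
/- (VC-dimension of the majority-vote class.) There is an absolute constant C > 0 with the following property. Let X be a set and H a class of functions h : X → {0,1} with VC-dimension at most d, where d ≥ 1. For a positive integer T, let H̄ = {MAJ(h_1,…,h_T) : h_1,…,h_T ∈ H}, where MAJ(h_1,…,h_T)(x) = 1 if ∑_{i=1}^T h_i(x) > T/2 and 0 otherwise. Then the VC-dimension of H̄ is at most C·T·d·log(T·d + 1). -/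
universe u

open Finset in
theorem sum_choose_le_succ_pow (n d : ℕ) :
    ∑ k ∈ range (d + 1), n.choose k ≤ (n + 1) ^ d := by
  rw [add_pow]
  refine sum_le_sum fun k hk => ?_
  have hkd : 0 < d.choose k := Nat.choose_pos (by simpa [Nat.lt_succ_iff] using hk)
  simpa using (Nat.choose_le_pow n k).trans (Nat.le_mul_of_pos_right _ hkd)

open Classical Finset in
/-- The traces on `W` of the members of `H`. -/
noncomputable def traceFamily {X : Type*} (H : Set (X → Bool)) (W : Finset X) :
    Finset (Finset X) :=
  W.powerset.filter fun A => ∃ h ∈ H, A = W.filter fun x => h x = true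

open Classical Finset in
/-- Sauer–Shelah bound for the number of traces. -/
theorem card_traceFamily_le {X : Type*} {H : Set (X → Bool)} {d : ℕ}
    (hH : ∀ W : Finset X, W.card = d + 1 →
      ¬ (∀ g : X → Bool, ∃ h ∈ H, ∀ x ∈ W, h x = g x)) (W : Finset X) :
    #(traceFamily H W) ≤ (#W + 1) ^ d := by
  refine le_trans ?_ (sum_choose_le_succ_pow #W d)
  refine (card_le_card_shatterer _).trans ?_
  have hsub : (traceFamily H W).shatterer ⊆
      (range (d + 1)).biUnion fun k => powersetCard k W := by
    intro t ht
    rw [mem_shatterer] at ht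
    obtain ⟨v, hv, htv⟩ := ht.exists_superset
    have hvW : v ⊆ W := mem_powerset.1 (mem_filter.1 hv).1
    simp only [mem_biUnion, mem_range, mem_powersetCard]
    refine ⟨#t, ?_, htv.trans hvW, rfl⟩
    by_contra! hcard
    obtain ⟨s, hst, hs⟩ := exists_subset_card_eq hcard
    refine hH s hs fun g => ?_
    obtain ⟨u, hu, hsu⟩ := (ht.mono_right hst) (filter_subset (fun x => g x = true) s)
    obtain ⟨-, h, hh, rfl⟩ := mem_filter.1 hu
    refine ⟨h, hh, fun x hx => ?_⟩
    have hxW : x ∈ W := hvW (htv (hst hx))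
    have := Finset.ext_iff.1 hsu x
    simp only [mem_inter, mem_filter, hx, hxW, true_and] at this
    exact Bool.eq_iff_iff.2 this
  refine (card_le_card hsub).trans (card_biUnion_le.trans ?_)
  simp

open Classical Finset in
theorem two_pow_card_le_of_majority_shatters {X : Type*} {H : Set (X → Bool)} {T : ℕ}
    {W : Finset X}
    (hW : ∀ g : X → Bool, ∃ hs : Fin T → (X → Bool), (∀ i, hs i ∈ H) ∧
      ∀ x ∈ W,
        decide (T < 2 * (Finset.univ.filter (fun i : Fin T => hs i x = true)).card) = g x) :
    2 ^ #W ≤ #(traceFamily H W) ^ T := by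
  have hsub : W.powerset ⊆ (Fintype.piFinset fun _ : Fin T => traceFamily H W).image
      fun A => W.filter fun x => T < 2 * #{i | x ∈ A i} := by
    intro B hB
    obtain ⟨hs, hsH, hmaj⟩ := hW fun x => decide (x ∈ B)
    refine mem_image.2 ⟨fun i => W.filter fun x => hs i x = true, ?_, ?_⟩
    · simp only [Fintype.mem_piFinset, traceFamily, mem_filter, mem_powerset]
      exact fun i => ⟨filter_subset _ _, hs i, hsH i, rfl⟩
    · ext x
      by_cases hx : x ∈ W
      · simpa [hx] using hmaj x hx
      · simpa [hx] using fun hxB => hx (mem_powerset.1 hB hxB)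
  simpa using (card_le_card hsub).trans card_image_le

theorem le_mul_log_of_two_pow_le {n m : ℕ} (hm : 1 ≤ m) (h : 2 ^ n ≤ (n + 1) ^ m) :
    (n : ℝ) ≤ 10 * m * Real.log (m + 1) := by
  have hm' : (1 : ℝ) ≤ m := by exact_mod_cast hm
  have hlog : (n : ℝ) * Real.log 2 ≤ m * Real.log (n + 1) := by
    rw [← Real.log_pow, ← Real.log_pow]
    exact Real.log_le_log (by positivity) (by exact_mod_cast h)
  have htangent : Real.log (n + 1) ≤ (n + 1) / (4 * m) - 1 + Real.log (4 * m) := by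
    have := Real.log_le_sub_one_of_pos (show (0 : ℝ) < (n + 1) / (4 * m) by positivity)
    rw [Real.log_div (by positivity) (by positivity)] at this
    linarith
  have hmul : (m : ℝ) * Real.log (n + 1) ≤ (n + 1) / 4 - m + m * Real.log (4 * m) := by
    refine (mul_le_mul_of_nonneg_left htangent (by positivity)).trans_eq ?_
    field_simp
  have hlog4 : Real.log (4 * m) ≤ 3 * Real.log (m + 1) := by
    rw [show 3 * Real.log ((m : ℝ) + 1) = Real.log ((m + 1) ^ 3) by simp]
    exact Real.log_le_log (by positivity) (by nlinarith [sq_nonneg ((m : ℝ) - 1)])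
  have hmlog := mul_le_mul_of_nonneg_left hlog4 (show (0 : ℝ) ≤ m by positivity)
  have hn : (0 : ℝ) ≤ n := by positivity
  nlinarith [Real.log_two_gt_d9]

/-- VC-dimension of the majority-vote class: There is an absolute
constant `C > 0` such that for every set `X`, every class `H` of Boolean hypotheses of
VC-dimension at most `d ≥ 1` (no set of `d+1` points is shattered by `H`) and every
`T ≥ 1`, the class `H̄ = {MAJ(h_1,…,h_T) : h_i ∈ H}` has VC-dimension at most
`C·T·d·log(T·d+1)`: every finite set shattered by `H̄` has size at most
`C·T·d·log(T·d+1)`. Here `MAJ(h_1,…,h_T)(x) = 1` iff `∑_i h_i(x) > T/2`. -/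
theorem stmt_14 : ∃ C : ℝ, 0 < C ∧
    ∀ (X : Type u) (H : Set (X → Bool)) (d : ℕ), 1 ≤ d →
      (∀ W : Finset X, W.card = d + 1 →
        ¬ (∀ g : X → Bool, ∃ h ∈ H, ∀ x ∈ W, h x = g x)) →
      ∀ T : ℕ, 0 < T →
        ∀ W : Finset X,
          (∀ g : X → Bool, ∃ hs : Fin T → (X → Bool), (∀ i, hs i ∈ H) ∧
            ∀ x ∈ W,
              decide (T < 2 * (Finset.univ.filter (fun i : Fin T => hs i x = true)).card)
                = g x) →
          (W.card : ℝ) ≤ C * T * d * Real.log ((T : ℝ) * d + 1) := by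
  refine ⟨10, by norm_num, fun X H d hd hH T hT W hW => ?_⟩
  have hpow : 2 ^ W.card ≤ (W.card + 1) ^ (T * d) :=
    calc 2 ^ W.card ≤ (traceFamily H W).card ^ T := two_pow_card_le_of_majority_shatters hW
      _ ≤ ((W.card + 1) ^ d) ^ T := Nat.pow_le_pow_left (card_traceFamily_le hH W) T
      _ = (W.card + 1) ^ (T * d) := by rw [← pow_mul, mul_comm]
  simpa [mul_assoc] using le_mul_log_of_two_pow_le (Nat.mul_pos hT hd) hpow
end
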